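/- arXiv:1609.08801 — 2 statements merged into one kernel-verified Lean document; each statement's English description precedes it below -/
import Mathlib

section
/- Let G = (V,E) be a finite connected simple graph, let 0 < δ < 1, let ℓ > 0, and let t be a function assigning to each unordered pair of distinct vertices a nonnegative real. Suppose that for every assignment of positive, pairwise-distinct edge weights w:E→ℝ there exists a spanner H of (G,w) with lightness at most ℓ such that every pair u,v ∈ V satisfies d_H(u,v) ≤ t(u,v)·d_G(u,v). Then for every such weight function w there exists a spanner H of (G,w) that contains the minimum spanning tree of (G,w), has lightness at most 1 + δℓ, and satisfies d_H(u,v) ≤ (t(u,v)/δ)·d_G(u,v) for every pair u,v ∈ V. -/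
open Finset

attribute [local instance] Classical.propDecidable

section Defs

variable {V : Type*} [Fintype V]

/-- Total weight of a (sub)graph: the sum of its edge weights. -/
noncomputable def wWeight (H : SimpleGraph V) (w : Sym2 V → ℝ) : ℝ :=
  ∑ e ∈ H.edgeSet.toFinite.toFinset, w e

/-- Shortest-path distance in a weighted graph: infimum of walk weights. -/
noncomputable def wdist (G : SimpleGraph V) (w : Sym2 V → ℝ) (u v : V) : ℝ :=
  sInf {x : ℝ | ∃ p : G.Walk u v, x = (p.edges.map w).sum}

/-- `T` is a spanning tree of `G`. -/
def IsSpanningTree (G T : SimpleGraph V) : Prop :=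
  T ≤ G ∧ T.IsTree

/-- Weight of a minimum spanning tree of `G`. -/
noncomputable def mstWeight (G : SimpleGraph V) (w : Sym2 V → ℝ) : ℝ :=
  sInf {x : ℝ | ∃ T : SimpleGraph V, IsSpanningTree G T ∧ x = wWeight T w}

/-- `T` is a minimum spanning tree of `G`. -/
def IsMST (G : SimpleGraph V) (w : Sym2 V → ℝ) (T : SimpleGraph V) : Prop :=
  IsSpanningTree G T ∧ ∀ T' : SimpleGraph V, IsSpanningTree G T' → wWeight T w ≤ wWeight T' w

/-- A spanner of `G`: a connected spanning subgraph. -/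
def IsSpanner (G H : SimpleGraph V) : Prop := H ≤ G ∧ H.Connected

/-- `G` together with `w` is a weighted graph: connected, positive pairwise-distinct
edge weights. -/
def IsWeightedGraph (G : SimpleGraph V) (w : Sym2 V → ℝ) : Prop :=
  G.Connected ∧ (∀ e ∈ G.edgeSet, 0 < w e) ∧
    (∀ e ∈ G.edgeSet, ∀ e' ∈ G.edgeSet, e ≠ e' → w e ≠ w e')

/-- The ordered pairs of distinct vertices whose distortion in `H` is at most `t`. -/
noncomputable def goodPairs (G H : SimpleGraph V) (w : Sym2 V → ℝ) (t : ℝ) : Finset (V × V) :=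
  Finset.univ.offDiag.filter (fun p => wdist H w p.1 p.2 ≤ t * wdist G w p.1 p.2)

/-- Scaling distortion `γ`: for every `ε ∈ (0,1)`, at least a `(1-ε)` fraction of the
pairs of distinct vertices have distortion at most `γ ε`.  (Counted over ordered pairs:
`n·(n-1) = 2·(n choose 2)`.) -/
def HasScalingDistortion (G H : SimpleGraph V) (w : Sym2 V → ℝ) (γ : ℝ → ℝ) : Prop :=
  ∀ ε : ℝ, 0 < ε → ε < 1 →
    (1 - ε) * ((Fintype.card V : ℝ) * ((Fintype.card V : ℝ) - 1)) ≤
      ((goodPairs G H w (γ ε)).card : ℝ)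

/-- The `ℓ_q`-distortion of the spanner `H` of `G`. -/
noncomputable def distq (G H : SimpleGraph V) (w : Sym2 V → ℝ) (q : ℝ) : ℝ :=
  ((∑ p ∈ (Finset.univ : Finset V).offDiag, (wdist H w p.1 p.2 / wdist G w p.1 p.2) ^ q) /
    ((Fintype.card V : ℝ) * ((Fintype.card V : ℝ) - 1))) ^ (1 / q)

/-- `R(v,ε)`: the minimal radius `r` such that the ball `B(v,r)` contains at least `εn`
vertices. -/
noncomputable def Rgraph (G : SimpleGraph V) (w : Sym2 V → ℝ) (v : V) (ε : ℝ) : ℝ :=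
  sInf {r : ℝ | 0 ≤ r ∧
    ε * (Fintype.card V : ℝ) ≤ ((Finset.univ.filter (fun u => wdist G w u v ≤ r)).card : ℝ)}

/-- Coarse scaling distortion `γ`: every pair of distinct vertices that are mutually
`ε/2`-far has distortion at most `γ ε`. -/
def HasCoarseScalingDistortion (G H : SimpleGraph V) (w : Sym2 V → ℝ) (γ : ℝ → ℝ) : Prop :=
  ∀ ε : ℝ, 0 < ε → ε < 1 → ∀ u v : V, u ≠ v →
    Rgraph G w v (ε / 2) ≤ wdist G w u v → Rgraph G w u (ε / 2) ≤ wdist G w u v →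
    wdist H w u v ≤ γ ε * wdist G w u v

end Defs

section Auxiliary

variable {V : Type*}

theorem mem_edgeFinset_iff [Fintype V] (H : SimpleGraph V) (e : Sym2 V) :
    e ∈ H.edgeSet.toFinite.toFinset ↔ e ∈ H.edgeSet := by simp

theorem wdist_le_mul_wdist {H K : SimpleGraph V} {w w' : Sym2 V → ℝ} {c : ℝ}
    (hHK : H ≤ K) (hH : H.Connected) (hc : 0 < c) (hw : ∀ e ∈ K.edgeSet, 0 ≤ w e)
    (hww' : ∀ e ∈ H.edgeSet, w e ≤ c * w' e) (u v : V) :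
    wdist K w u v ≤ c * wdist H w' u v := by
  rw [mul_comm, ← div_le_iff₀ hc]
  obtain ⟨p₀⟩ := hH.preconnected u v
  refine le_csInf ⟨_, p₀, rfl⟩ ?_
  rintro _ ⟨p, rfl⟩
  rw [div_le_iff₀ hc]
  have hbdd : BddBelow {x : ℝ | ∃ q : K.Walk u v, x = (q.edges.map w).sum} := by
    refine ⟨0, ?_⟩
    rintro _ ⟨q, rfl⟩
    refine List.sum_nonneg fun x hx => ?_
    obtain ⟨e, he, rfl⟩ := List.mem_map.1 hx
    exact hw e (q.edges_subset_edgeSet he)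
  refine (csInf_le hbdd ⟨p.mapLe hHK, rfl⟩).trans ?_
  rw [SimpleGraph.Walk.edges_mapLe_eq_edges, mul_comm, ← List.sum_map_mul_left]
  exact List.sum_le_sum fun e he => hww' e (p.edges_subset_edgeSet he)

theorem exists_isMST [Fintype V] {G : SimpleGraph V} (hG : G.Connected) (w : Sym2 V → ℝ) :
    ∃ T, IsMST G w T := by
  obtain ⟨T₀, hle, hT₀⟩ := hG.exists_isTree_le
  obtain ⟨T, hT, hmin⟩ := Set.exists_min_image {T | IsSpanningTree G T}
    (fun T => wWeight T w) (Set.toFinite _) ⟨T₀, hle, hT₀⟩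
  exact ⟨T, hT, hmin⟩

theorem IsMST.mstWeight_eq [Fintype V] {G T : SimpleGraph V} {w : Sym2 V → ℝ} (hT : IsMST G w T) :
    mstWeight G w = wWeight T w := by
  refine IsLeast.csInf_eq ⟨⟨T, hT.1, rfl⟩, ?_⟩
  rintro _ ⟨T', hT', rfl⟩
  exact hT.2 T' hT'

theorem wWeight_nonneg [Fintype V] {H : SimpleGraph V} {w : Sym2 V → ℝ} (hw : ∀ e ∈ H.edgeSet, 0 ≤ w e) :
    0 ≤ wWeight H w :=
  Finset.sum_nonneg fun e he => hw e ((mem_edgeFinset_iff H e).1 he)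

theorem wWeight_le_wWeight [Fintype V] {H : SimpleGraph V} {w w' : Sym2 V → ℝ}
    (h : ∀ e ∈ H.edgeSet, w e ≤ w' e) : wWeight H w ≤ wWeight H w' :=
  Finset.sum_le_sum fun e he => h e ((mem_edgeFinset_iff H e).1 he)

/-- The weights obtained from `w` by dividing by `δ` the weight of each edge outside `T`. -/
noncomputable def stretchOutside (T : SimpleGraph V) (w : Sym2 V → ℝ) (δ : ℝ) (e : Sym2 V) : ℝ :=
  if e ∈ T.edgeSet then w e else w e / δ

theorem le_stretchOutside (T : SimpleGraph V) {w : Sym2 V → ℝ} {δ : ℝ} (hδ0 : 0 < δ)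
    (hδ1 : δ ≤ 1) {e : Sym2 V} (he : 0 ≤ w e) : w e ≤ stretchOutside T w δ e := by
  unfold stretchOutside
  split_ifs
  · exact le_rfl
  · exact le_div_self he hδ0 hδ1

theorem stretchOutside_le (T : SimpleGraph V) {w : Sym2 V → ℝ} {δ : ℝ} (hδ0 : 0 < δ)
    (hδ1 : δ ≤ 1) {e : Sym2 V} (he : 0 ≤ w e) : stretchOutside T w δ e ≤ w e / δ := by
  unfold stretchOutside
  split_ifs
  · exact le_div_self he hδ0 hδ1
  · exact le_rfl

theorem stretchOutside_ne (T : SimpleGraph V) {w : Sym2 V → ℝ} {δ : ℝ} (hδ0 : 0 < δ)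
    (hδ : ∀ e f : Sym2 V, w e / w f ≠ δ) {e f : Sym2 V} (he : 0 < w e) (hf : 0 < w f)
    (hef : w e ≠ w f) : stretchOutside T w δ e ≠ stretchOutside T w δ f := by
  unfold stretchOutside
  split_ifs
  · exact hef
  · intro h
    refine hδ f e ?_
    rw [h]
    field_simp
  · intro h
    refine hδ e f ?_
    rw [← h]
    field_simp
  · exact fun h => hef ((div_left_inj' hδ0.ne').1 h)

theorem wWeight_stretchOutside_self [Fintype V] (T : SimpleGraph V) (w : Sym2 V → ℝ) (δ : ℝ) :
    wWeight T (stretchOutside T w δ) = wWeight T w :=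
  Finset.sum_congr rfl fun e he => if_pos ((mem_edgeFinset_iff T e).1 he)

theorem IsMST.stretchOutside [Fintype V] {G T : SimpleGraph V} {w : Sym2 V → ℝ} {δ : ℝ}
    (hT : IsMST G w T) (hw : ∀ e ∈ G.edgeSet, 0 ≤ w e) (hδ0 : 0 < δ) (hδ1 : δ ≤ 1) :
    IsMST G (stretchOutside T w δ) T := by
  refine ⟨hT.1, fun T' hT' => ?_⟩
  rw [wWeight_stretchOutside_self]
  exact (hT.2 T' hT').trans <| wWeight_le_wWeight fun e he =>
    le_stretchOutside T hδ0 hδ1 (hw e (SimpleGraph.edgeSet_mono hT'.1 he))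

theorem wWeight_sup_le [Fintype V] (H T : SimpleGraph V) {w : Sym2 V → ℝ} {δ : ℝ} (hδ0 : 0 < δ)
    (hw : ∀ e ∈ H.edgeSet, 0 ≤ w e) :
    wWeight (H ⊔ T) w ≤ wWeight T w + δ * wWeight H (stretchOutside T w δ) := by
  have hunion : (H ⊔ T).edgeSet.toFinite.toFinset =
      T.edgeSet.toFinite.toFinset ∪
        (H.edgeSet.toFinite.toFinset \ T.edgeSet.toFinite.toFinset) := by
    ext e
    simp [or_comm]
  unfold wWeight
  rw [hunion, Finset.sum_union Finset.disjoint_sdiff, Finset.mul_sum]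
  gcongr
  calc ∑ e ∈ H.edgeSet.toFinite.toFinset \ T.edgeSet.toFinite.toFinset, w e
      = ∑ e ∈ H.edgeSet.toFinite.toFinset \ T.edgeSet.toFinite.toFinset,
          δ * stretchOutside T w δ e := by
        refine Finset.sum_congr rfl fun e he => ?_
        rw [Finset.mem_sdiff, mem_edgeFinset_iff, mem_edgeFinset_iff] at he
        rw [stretchOutside, if_neg he.2]
        field_simp
    _ ≤ _ := by
        refine Finset.sum_le_sum_of_subset_of_nonneg Finset.sdiff_subset fun e he _ => ?_
        have h := hw e ((mem_edgeFinset_iff H e).1 he)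
        unfold stretchOutside
        split_ifs <;> positivity

end Auxiliary

/-- A black-box reduction: if for every (positive, pairwise-distinct)
weight function on `G` there is a spanner of lightness at most `ℓ` with per-pair
distortion bound `t(u,v)`, then for every such weight function there is a spanner
containing the MST, of lightness at most `1 + δℓ`, with per-pair distortion bound
`t(u,v)/δ`. -/
theorem stmt5 {V : Type} [Fintype V] (G : SimpleGraph V) (hG : G.Connected)
    (δ ℓ : ℝ) (hδ0 : 0 < δ) (hδ1 : δ < 1) (hℓ : 0 < ℓ)
    (t : V → V → ℝ) (ht0 : ∀ u v : V, 0 ≤ t u v) (htsymm : ∀ u v : V, t u v = t v u)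
    (hyp : ∀ w : Sym2 V → ℝ, (∀ e ∈ G.edgeSet, 0 < w e) →
      (∀ e ∈ G.edgeSet, ∀ e' ∈ G.edgeSet, e ≠ e' → w e ≠ w e') →
      ∃ H : SimpleGraph V, IsSpanner G H ∧
        wWeight H w / mstWeight G w ≤ ℓ ∧
        ∀ u v : V, wdist H w u v ≤ t u v * wdist G w u v) :
    ∀ w : Sym2 V → ℝ, (∀ e ∈ G.edgeSet, 0 < w e) →
      (∀ e ∈ G.edgeSet, ∀ e' ∈ G.edgeSet, e ≠ e' → w e ≠ w e') →
      ∃ H : SimpleGraph V, IsSpanner G H ∧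
        (∃ T : SimpleGraph V, IsMST G w T ∧ T ≤ H) ∧
        wWeight H w / mstWeight G w ≤ 1 + δ * ℓ ∧
        ∀ u v : V, wdist H w u v ≤ (t u v / δ) * wdist G w u v := by
  intro w hw hinj
  have hw0 : ∀ e ∈ G.edgeSet, 0 ≤ w e := fun e he => (hw e he).le
  obtain ⟨T, hT⟩ := exists_isMST hG w
  have hTG := hT.1.1
  have key : ∀ δ' : ℝ, δ < δ' → δ' < 1 → (∀ e f : Sym2 V, w e / w f ≠ δ') →
      ∃ H : SimpleGraph V, (IsSpanner G H ∧ T ≤ H ∧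
        ∀ u v : V, wdist H w u v ≤ (t u v / δ) * wdist G w u v) ∧
        wWeight H w / mstWeight G w ≤ 1 + δ' * ℓ := by
    intro δ' hδδ' hδ'1 hδ'
    have hδ'0 := hδ0.trans hδδ'
    obtain ⟨H, ⟨hHG, hH⟩, hlight, hdist⟩ := hyp (stretchOutside T w δ')
      (fun e he => (hw e he).trans_le (le_stretchOutside T hδ'0 hδ'1.le (hw0 e he)))
      (fun e he f hf hef =>
        stretchOutside_ne T hδ'0 hδ' (hw e he) (hw f hf) (hinj e he f hf hef))
    have hsup : H ⊔ T ≤ G := sup_le hHG hTG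
    refine ⟨H ⊔ T, ⟨⟨hsup, hH.mono le_sup_left⟩, le_sup_right, fun u v => ?_⟩, ?_⟩
    · have hdH : wdist (H ⊔ T) w u v ≤ 1 * wdist H (stretchOutside T w δ') u v :=
        wdist_le_mul_wdist le_sup_left hH one_pos
          (fun e he => hw0 e (SimpleGraph.edgeSet_mono hsup he))
          (fun e he => by
            rw [one_mul]
            exact le_stretchOutside T hδ'0 hδ'1.le (hw0 e (SimpleGraph.edgeSet_mono hHG he))) u v
      have hdG : wdist G (stretchOutside T w δ') u v ≤ δ⁻¹ * wdist G w u v :=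
        wdist_le_mul_wdist le_rfl hG (inv_pos.2 hδ0)
          (fun e he => (hw0 e he).trans (le_stretchOutside T hδ'0 hδ'1.le (hw0 e he)))
          (fun e he => by
            refine (stretchOutside_le T hδ'0 hδ'1.le (hw0 e he)).trans ?_
            rw [inv_mul_eq_div]
            exact div_le_div_of_nonneg_left (hw0 e he) hδ0 hδδ'.le) u v
      calc wdist (H ⊔ T) w u v ≤ wdist H (stretchOutside T w δ') u v := by rwa [one_mul] at hdH
        _ ≤ t u v * wdist G (stretchOutside T w δ') u v := hdist u v
        _ ≤ t u v * (δ⁻¹ * wdist G w u v) := mul_le_mul_of_nonneg_left hdG (ht0 u v)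
        _ = t u v / δ * wdist G w u v := by ring
    · rw [(hT.stretchOutside hw0 hδ'0 hδ'1.le).mstWeight_eq, wWeight_stretchOutside_self] at hlight
      rw [hT.mstWeight_eq]
      have hT0 : 0 ≤ wWeight T w :=
        wWeight_nonneg fun e he => hw0 e (SimpleGraph.edgeSet_mono hTG he)
      rcases hT0.eq_or_lt with h0 | hpos
      · rw [← h0, div_zero]
        positivity
      · rw [div_le_iff₀ hpos] at hlight ⊢
        calc wWeight (H ⊔ T) w ≤ wWeight T w + δ' * wWeight H (stretchOutside T w δ') :=
              wWeight_sup_le H T hδ'0 fun e he => hw0 e (SimpleGraph.edgeSet_mono hHG he)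
          _ ≤ wWeight T w + δ' * (ℓ * wWeight T w) := by gcongr
          _ = (1 + δ' * ℓ) * wWeight T w := by ring
  have exists_scale : ∀ b : ℝ, δ < b → ∃ δ' ∈ Set.Ioo δ b, ∀ e f : Sym2 V, w e / w f ≠ δ' := by
    intro b hb
    obtain ⟨δ', hmem, hδ'⟩ := (Set.Ioo_infinite hb).exists_notMem_finite
      (Set.finite_range fun p : Sym2 V × Sym2 V => w p.1 / w p.2)
    exact ⟨δ', hmem, fun e f h => hδ' ⟨(e, f), h⟩⟩
  obtain ⟨δ₀, ⟨hδδ₀, hδ₀1⟩, hδ₀⟩ := exists_scale 1 hδ1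
  obtain ⟨H₀, hH₀, -⟩ := key δ₀ hδδ₀ hδ₀1 hδ₀
  obtain ⟨H, ⟨hspan, hTH, hdist⟩, hmin⟩ := Set.exists_min_image
    {H : SimpleGraph V | IsSpanner G H ∧ T ≤ H ∧
      ∀ u v : V, wdist H w u v ≤ (t u v / δ) * wdist G w u v}
    (fun H => wWeight H w / mstWeight G w) (Set.toFinite _) ⟨H₀, hH₀⟩
  refine ⟨H, hspan, ⟨T, hT, hTH⟩, ?_, hdist⟩
  by_contra! hlt
  have hb : δ < min 1 ((wWeight H w / mstWeight G w - 1) / ℓ) := by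
    refine lt_min hδ1 ?_
    rw [lt_div_iff₀ hℓ]
    linarith
  obtain ⟨δ', ⟨hδδ', hδ'b⟩, hδ'⟩ := exists_scale _ hb
  obtain ⟨hδ'1, hδ'H⟩ := lt_min_iff.1 hδ'b
  obtain ⟨K, hK, hKlight⟩ := key δ' hδδ' hδ'1 hδ'
  rw [lt_div_iff₀ hℓ] at hδ'H
  linarith [hmin K hK]
end

section
/- For every weighted graph G = (V,E,w), every parameter α > 1, and every nonempty subset K ⊆ V, there exists a spanner S of G with lightness Ψ(S) ≤ 1 + 2/(α−1) such that for every vertex u ∈ V, d_S(u,K) ≤ α · d_G(u,K). -/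
open Finset

attribute [local instance] Classical.propDecidable

section Helpers

open SimpleGraph

variable {V : Type*} {G H T : SimpleGraph V} {w : Sym2 V → ℝ}

/-- The total weight of a walk, counted with multiplicity. -/
noncomputable def walkWeight (w : Sym2 V → ℝ) {u v : V} (p : G.Walk u v) : ℝ :=
  (p.edges.map w).sum

@[simp]
lemma walkWeight_nil (u : V) : walkWeight w (Walk.nil : G.Walk u u) = 0 := by
  simp [walkWeight]

@[simp]
lemma walkWeight_cons {u v x : V} (h : G.Adj u v) (p : G.Walk v x) :
    walkWeight w (Walk.cons h p) = w s(u, v) + walkWeight w p := by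
  simp [walkWeight]

lemma walkWeight_mapLe (h : G ≤ H) {u v : V} (p : G.Walk u v) :
    walkWeight w (p.mapLe h) = walkWeight w p := by
  induction p with
  | nil => simp
  | cons hadj p ih => simp_all

lemma walkWeight_nonneg (hw : ∀ e ∈ G.edgeSet, 0 ≤ w e) {u v : V} (p : G.Walk u v) :
    0 ≤ walkWeight w p := by
  refine List.sum_nonneg fun x hx => ?_
  obtain ⟨e, he, rfl⟩ := List.mem_map.1 hx
  exact hw e (p.edges_subset_edgeSet he)

lemma walkWeight_bypass_le (hw : ∀ e ∈ G.edgeSet, 0 ≤ w e) {u v : V} (p : G.Walk u v) :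
    walkWeight w p.bypass ≤ walkWeight w p := by
  refine List.Sublist.sum_le_sum (p.edges_bypass_sublist_edges.map w) fun x hx => ?_
  obtain ⟨e, he, rfl⟩ := List.mem_map.1 hx
  exact hw e (p.edges_subset_edgeSet he)

/-- `c` bounds the length of some walk of `H` from `u` to `K`. -/
def ReachesWithin (H : SimpleGraph V) (w : Sym2 V → ℝ) (K : Set V) (u : V) (c : ℝ) : Prop :=
  ∃ k ∈ K, ∃ p : H.Walk u k, walkWeight w p ≤ c

lemma ReachesWithin.mono {K : Set V} {u : V} {c c' : ℝ} (h : ReachesWithin G w K u c)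
    (hGH : G ≤ H) (hc : c ≤ c') : ReachesWithin H w K u c' := by
  obtain ⟨k, hk, p, hp⟩ := h
  exact ⟨k, hk, p.mapLe hGH, by rw [walkWeight_mapLe]; exact hp.trans hc⟩

lemma ReachesWithin.cons {K : Set V} {u v : V} {c : ℝ} (h : ReachesWithin G w K v c)
    (hadj : G.Adj u v) : ReachesWithin G w K u (w s(u, v) + c) := by
  obtain ⟨k, hk, p, hp⟩ := h
  exact ⟨k, hk, p.cons hadj, by simpa using hp⟩

lemma wdist_le_walkWeight (hw : ∀ e ∈ G.edgeSet, 0 ≤ w e) {u v : V} (p : G.Walk u v) :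
    wdist G w u v ≤ walkWeight w p :=
  csInf_le ⟨0, by rintro _ ⟨q, rfl⟩; exact walkWeight_nonneg hw q⟩ ⟨p, rfl⟩

lemma sInf_wdist_nonneg (hw : ∀ e ∈ G.edgeSet, 0 ≤ w e) (K : Set V) (u : V) :
    0 ≤ sInf ((fun x => wdist G w u x) '' K) := by
  refine Real.sInf_nonneg ?_
  rintro _ ⟨k, -, rfl⟩
  refine Real.sInf_nonneg ?_
  rintro _ ⟨p, rfl⟩
  exact walkWeight_nonneg hw p

variable [Fintype V]

lemma exists_walkWeight_eq_wdist (hG : G.Connected) (hw : ∀ e ∈ G.edgeSet, 0 ≤ w e) (u v : V) :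
    ∃ p : G.Walk u v, walkWeight w p = wdist G w u v := by
  have : Nonempty (G.Path u v) := ⟨(hG.preconnected u v).some.toPath⟩
  obtain ⟨q, hq⟩ := Finite.exists_min fun q : G.Path u v => walkWeight w q.1
  refine ⟨q.1, le_antisymm (le_csInf ⟨_, q.1, rfl⟩ ?_) (wdist_le_walkWeight hw q.1)⟩
  rintro _ ⟨p, rfl⟩
  exact (hq p.toPath).trans (walkWeight_bypass_le hw p)

lemma sInf_wdist_le_of_reachesWithin (hw : ∀ e ∈ G.edgeSet, 0 ≤ w e) {K : Set V} {u : V} {c : ℝ}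
    (h : ReachesWithin G w K u c) : sInf ((fun x => wdist G w u x) '' K) ≤ c := by
  obtain ⟨k, hk, p, hp⟩ := h
  exact (csInf_le (Set.toFinite _).bddBelow (Set.mem_image_of_mem _ hk)).trans
    ((wdist_le_walkWeight hw p).trans hp)

lemma reachesWithin_sInf_wdist (hG : G.Connected) (hw : ∀ e ∈ G.edgeSet, 0 ≤ w e) {K : Set V}
    (hK : K.Nonempty) (u : V) :
    ReachesWithin G w K u (sInf ((fun x => wdist G w u x) '' K)) := by
  obtain ⟨k, hk, hkeq⟩ := (hK.image (fun x => wdist G w u x)).csInf_mem (Set.toFinite _)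
  obtain ⟨p, hp⟩ := exists_walkWeight_eq_wdist hG hw u k
  exact ⟨k, hk, p, by rw [hp, ← hkeq]⟩

lemma wWeight_nonneg_s6 (hw : ∀ e ∈ G.edgeSet, 0 ≤ w e) : 0 ≤ wWeight G w :=
  Finset.sum_nonneg fun e he => hw e (by simpa using he)

lemma wWeight_sup_edge_le {u v : V} (h : 0 ≤ w s(u, v)) :
    wWeight (G ⊔ edge u v) w ≤ wWeight G w + w s(u, v) := by
  by_cases hle : edge u v ≤ G
  · rw [sup_eq_left.2 hle]
    linarith
  · obtain ⟨hne, hadj⟩ := not_or.1 fun h' => hle ((edge_le_iff G).2 h')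
    have hins : (G ⊔ edge u v).edgeSet.toFinite.toFinset =
        insert s(u, v) G.edgeSet.toFinite.toFinset := by
      ext e
      simp only [Set.Finite.mem_toFinset, edgeSet_sup, edgeSet_edge_of_ne hne, Set.mem_union,
        Set.mem_singleton_iff, Finset.mem_insert, or_comm]
    rw [wWeight, hins, Finset.sum_insert (by simpa using hadj), add_comm, wWeight]

/-- Adding a walk of `G` to a subgraph `H` costs at most the weight of the walk. -/
lemma exists_le_walkWeight_le (hw : ∀ e ∈ G.edgeSet, 0 ≤ w e) (hHG : H ≤ G) {u v : V}
    (p : G.Walk u v) :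
    ∃ H', H ≤ H' ∧ H' ≤ G ∧ wWeight H' w ≤ wWeight H w + walkWeight w p ∧
      ∃ q : H'.Walk u v, walkWeight w q = walkWeight w p := by
  induction p with
  | nil => exact ⟨H, le_rfl, hHG, by simp, .nil, by simp⟩
  | @cons u x v hadj p ih =>
    obtain ⟨H', hHH', hHG', hwt, q, hq⟩ := ih
    have hadj' : (H' ⊔ edge u x).Adj u x := by
      simp [edge_adj, hadj.ne]
    refine ⟨H' ⊔ edge u x, hHH'.trans le_sup_left, sup_le hHG' ?_, ?_,
      .cons hadj' (q.mapLe le_sup_left), ?_⟩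
    · exact (edge_le_iff G).2 (.inr hadj)
    · have := wWeight_sup_edge_le (G := H') (hw s(u, x) hadj)
      rw [walkWeight_cons]
      linarith
    · rw [walkWeight_cons, walkWeight_cons, walkWeight_mapLe, hq]

/-- Detouring along pendant edges, a closed walk at `r` visits every vertex of a connected graph
at a cost of at most twice the weight of the graph. -/
lemma exists_closed_walk_walkWeight_le (hT : T.Connected) (hw : ∀ e ∈ T.edgeSet, 0 ≤ w e)
    (r : V) : ∃ p : T.Walk r r, (∀ v, v ∈ p.support) ∧ walkWeight w p ≤ 2 * wWeight T w := by
  have key : ∀ n : ℕ, n ≤ Fintype.card V → ∃ p : T.Walk r r,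
      n ≤ p.support.toFinset.card ∧ walkWeight w p ≤ 2 * ∑ e ∈ p.edges.toFinset, w e := by
    intro n hn
    induction n with
    | zero => exact ⟨.nil, by simp, by simp⟩
    | succ n ih =>
      obtain ⟨p, hcard, hwt⟩ := ih (by omega)
      by_cases hlt : n + 1 ≤ p.support.toFinset.card
      · exact ⟨p, hlt, hwt⟩
      obtain ⟨z, hz⟩ : ∃ z, z ∉ p.support := by
        by_contra! hall
        have : p.support.toFinset = univ := by ext; simp [hall]
        rw [this, Finset.card_univ] at hlt
        omega
      obtain ⟨⟨⟨x, y⟩, hadj⟩, -, hx, hy⟩ := (hT.preconnected r z).some.exists_boundary_dart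
        {v | v ∈ p.support} p.start_mem_support hz
      simp only [Set.mem_ofPred_eq] at hx hy
      let q : T.Walk r r :=
        (p.takeUntil x hx).append (.cons hadj (.cons hadj.symm (p.dropUntil x hx)))
      have hsplit : p.edges = (p.takeUntil x hx).edges ++ (p.dropUntil x hx).edges := by
        rw [← Walk.edges_append, Walk.take_spec]
      have hsupp : insert y p.support.toFinset ⊆ q.support.toFinset := by
        intro v hv
        rw [Finset.mem_insert, List.mem_toFinset] at hv
        rw [List.mem_toFinset]
        simp only [q, Walk.mem_support_append_iff, Walk.support_cons, List.mem_cons]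
        rcases hv with rfl | hv
        · simp
        · rw [← p.take_spec hx, Walk.mem_support_append_iff] at hv
          tauto
      have hedges : q.edges.toFinset = insert s(x, y) p.edges.toFinset := by
        ext e
        simp only [q, hsplit, Walk.edges_append, Walk.edges_cons, List.mem_toFinset,
          List.mem_append, List.mem_cons, Finset.mem_insert, Sym2.eq_swap (a := y) (b := x)]
        tauto
      have hnew : s(x, y) ∉ p.edges.toFinset := fun h =>
        hy (p.snd_mem_support_of_mem_edges (List.mem_toFinset.1 h))
      refine ⟨q, ?_, ?_⟩
      · have := Finset.card_le_card hsupp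
        rw [Finset.card_insert_of_notMem (by simpa using hy)] at this
        omega
      · have hq : walkWeight w q = walkWeight w p + 2 * w s(x, y) := by
          simp only [walkWeight, q, hsplit, Walk.edges_append, Walk.edges_cons, List.map_append,
            List.map_cons, List.sum_append, List.sum_cons, Sym2.eq_swap (a := y) (b := x)]
          ring
        rw [hedges, Finset.sum_insert hnew, hq]
        linarith
  obtain ⟨p, hcard, hwt⟩ := key _ le_rfl
  refine ⟨p, fun v => ?_, hwt.trans ?_⟩
  · have := Finset.eq_univ_of_card _ (le_antisymm (Finset.card_le_univ _) hcard)
    rw [← List.mem_toFinset, this]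
    exact Finset.mem_univ v
  · refine mul_le_mul_of_nonneg_left ?_ zero_le_two
    refine Finset.sum_le_sum_of_subset_of_nonneg (fun e he => ?_) fun e he _ => ?_
    · simpa using p.edges_subset_edgeSet (List.mem_toFinset.1 he)
    · exact hw e (by simpa using he)

/-- Following a walk of `H` and buying a shortest path to `K` whenever the current bound on the
distance to `K` becomes too large. -/
lemma exists_le_forall_mem_support_reachesWithin (hw : ∀ e ∈ G.edgeSet, 0 ≤ w e) {K : Set V}
    {α : ℝ} (hα : 1 < α) {D : V → ℝ} (hD : ∀ v, ReachesWithin G w K v (D v))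
    (hD0 : ∀ v, 0 ≤ D v) {u v : V} (p : T.Walk u v) (hTH : T ≤ H) (hHG : H ≤ G) {c : ℝ}
    (hc : ReachesWithin H w K u c) (hcα : c ≤ α * D u) :
    ∃ S, H ≤ S ∧ S ≤ G ∧ (∀ x ∈ p.support, ReachesWithin S w K x (α * D x)) ∧
      (α - 1) * (wWeight S w - wWeight H w) ≤ walkWeight w p + c := by
  induction p generalizing H c with
  | nil =>
    refine ⟨H, le_rfl, hHG, fun x hx => ?_, ?_⟩
    · obtain rfl : x = _ := by simpa using hx
      exact hc.mono le_rfl hcα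
    · obtain ⟨k, hk, q, hq⟩ := hc
      have := walkWeight_nonneg (fun e he => hw e (edgeSet_mono hHG he)) q
      simpa using this.trans hq
  | @cons u x v hadj p ih =>
    have hcx : ReachesWithin H w K x (w s(u, x) + c) := by
      rw [Sym2.eq_swap]
      exact hc.cons (hTH hadj.symm)
    by_cases hle : w s(u, x) + c ≤ α * D x
    · obtain ⟨S, hHS, hSG, hS, hwt⟩ := ih hTH hHG hcx hle
      refine ⟨S, hHS, hSG, fun y hy => ?_, ?_⟩
      · rw [Walk.support_cons, List.mem_cons] at hy
        rcases hy with rfl | hy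
        exacts [hc.mono hHS hcα, hS y hy]
      · rw [walkWeight_cons]
        linarith
    · obtain ⟨k, hk, q, hq⟩ := hD x
      obtain ⟨H', hHH', hHG', hwt', q', hq'⟩ := exists_le_walkWeight_le hw hHG q
      obtain ⟨S, hHS, hSG, hS, hwt⟩ := ih (hTH.trans hHH') hHG' ⟨k, hk, q', hq'.trans_le hq⟩
        (le_mul_of_one_le_left (hD0 x) hα.le)
      refine ⟨S, hHH'.trans hHS, hSG, fun y hy => ?_, ?_⟩
      · rw [Walk.support_cons, List.mem_cons] at hy
        rcases hy with rfl | hy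
        exacts [hc.mono (hHH'.trans hHS) hcα, hS y hy]
      · have := mul_le_mul_of_nonneg_left (hwt'.trans (add_le_add_right hq _)) (sub_nonneg.2 hα.le)
        rw [walkWeight_cons]
        linarith

lemma exists_isSpanningTree_wWeight_eq (hG : G.Connected) (w : Sym2 V → ℝ) :
    ∃ T, IsSpanningTree G T ∧ wWeight T w = mstWeight G w := by
  obtain ⟨T₀, hle, htree⟩ := hG.exists_isTree_le
  have hfin : {x : ℝ | ∃ T : SimpleGraph V, IsSpanningTree G T ∧ x = wWeight T w}.Finite :=
    (Set.finite_range fun T : SimpleGraph V => wWeight T w).subset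
      fun _ ⟨T, _, hx⟩ => ⟨T, hx.symm⟩
  have hne : {x : ℝ | ∃ T : SimpleGraph V, IsSpanningTree G T ∧ x = wWeight T w}.Nonempty :=
    ⟨wWeight T₀ w, T₀, ⟨hle, htree⟩, rfl⟩
  obtain ⟨T, hT, hx⟩ := hne.csInf_mem hfin
  exact ⟨T, hT, hx.symm⟩

end Helpers

/-- (Shallow-light trees.) For every weighted graph `G`, parameter
`α > 1` and nonempty `K ⊆ V`, there is a spanner `S` with lightness at most
`1 + 2/(α-1)` such that `d_S(u,K) ≤ α · d_G(u,K)` for every vertex `u`. -/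
theorem stmt6 {V : Type} [Fintype V] (G : SimpleGraph V) (w : Sym2 V → ℝ)
    (hG : IsWeightedGraph G w) (α : ℝ) (hα : 1 < α)
    (K : Set V) (hK : K.Nonempty) :
    ∃ S : SimpleGraph V, IsSpanner G S ∧
      wWeight S w / mstWeight G w ≤ 1 + 2 / (α - 1) ∧
      ∀ u : V,
        sInf ((fun x => wdist S w u x) '' K) ≤ α * sInf ((fun x => wdist G w u x) '' K) := by
  obtain ⟨hconn, hpos, -⟩ := hG
  have hw : ∀ e ∈ G.edgeSet, 0 ≤ w e := fun e he => (hpos e he).le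
  obtain ⟨T, ⟨hTG, hT⟩, hTw⟩ := exists_isSpanningTree_wWeight_eq hconn w
  have hwT : ∀ e ∈ T.edgeSet, 0 ≤ w e := fun e he => hw e (SimpleGraph.edgeSet_mono hTG he)
  obtain ⟨r, hr⟩ := hK
  obtain ⟨p, hp, hpw⟩ := exists_closed_walk_walkWeight_le hT.connected hwT r
  have hD0 := sInf_wdist_nonneg hw K
  obtain ⟨S, hTS, hSG, hS, hSw⟩ := exists_le_forall_mem_support_reachesWithin hw hα
    (reachesWithin_sInf_wdist hconn hw ⟨r, hr⟩) hD0 p le_rfl hTG (c := 0)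
    ⟨r, hr, .nil, by simp⟩ (mul_nonneg (by linarith) (hD0 r))
  have hα' : 0 < α - 1 := sub_pos.2 hα
  refine ⟨S, ⟨hSG, hT.connected.mono hTS⟩, ?_, fun u =>
    sInf_wdist_le_of_reachesWithin (fun e he => hw e (SimpleGraph.edgeSet_mono hSG he))
      (hS u (hp u))⟩
  rw [← hTw]
  refine div_le_of_le_mul₀ (wWeight_nonneg_s6 hwT) (by positivity) ?_
  have : wWeight S w - wWeight T w ≤ 2 * wWeight T w / (α - 1) := by
    rw [le_div_iff₀ hα']
    linarith
  calc wWeight S w ≤ wWeight T w + 2 * wWeight T w / (α - 1) := by linarith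
    _ = (1 + 2 / (α - 1)) * wWeight T w := by ring
end
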